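/- arXiv:1603.04926 — 3 statements merged into one kernel-verified Lean document; each statement's English description precedes it below -/
import Mathlib

section
/- Let R be a commutative ring and let A = R[χ^{±1}] be the Laurent polynomial ring over R. The R-algebra homomorphism φ from the Laurent polynomial ring R[x₁^{±1}, x₂^{±1}] to the product ring A × A determined by x₁ ↦ (χ, 1) and x₂ ↦ (1, χ) has kernel equal to the principal ideal generated by (x₁ − 1)(x₂ − 1), and its image equals the subring {(f₁, f₂) ∈ A × A : f₁ − f₂ lies in the ideal of A generated by (1 − χ)}. Consequently R[x₁^{±1}, x₂^{±1}]/((x₁ − 1)(x₂ − 1)) is isomorphic as an R-algebra to this subring. -/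
/-!
STATEMENT 0: Comparison of the Reisner–Stanley and GKM presentations of the
T-equivariant K-theory of ℙ¹.

`A = R[χ^{±1}]` is `LaurentPolynomial R`, with `χ = LaurentPolynomial.T 1`.
The two-variable Laurent polynomial ring `R[x₁^{±1}, x₂^{±1}]` is realized as the
group algebra `AddMonoidAlgebra R (ℤ × ℤ)`, with `x₁ = single (1,0) 1` and
`x₂ = single (0,1) 1`.  The product `A × A` is realized as `Fin 2 → A`.
-/

/-- The Laurent monomial with exponent vector `v` in `R[x₁^{±1}, x₂^{±1}]`. -/
noncomputable abbrev xMon (R : Type*) [CommRing R] (v : ℤ × ℤ) :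
    AddMonoidAlgebra R (ℤ × ℤ) :=
  AddMonoidAlgebra.single v 1

/-- Algebra homomorphisms out of `R[χ^{±1}]` are determined by their value at `χ`. -/
theorem laurent_algHom_ext {R S : Type*} [CommRing R] [CommRing S] [Algebra R S]
    {f g : LaurentPolynomial R →ₐ[R] S}
    (h : f (LaurentPolynomial.T 1) = g (LaurentPolynomial.T 1)) : f = g :=
  AddMonoidAlgebra.algHom_ext' (MonoidHom.ext_mint h) (by ext)

/-- Algebra homomorphisms out of the two-variable Laurent polynomial ring are determined by
their values at `x₁` and `x₂`. -/
theorem laurent₂_algHom_ext {R S : Type*} [CommRing R] [CommRing S] [Algebra R S]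
    {f g : AddMonoidAlgebra R (ℤ × ℤ) →ₐ[R] S}
    (h₁ : f (xMon R (1, 0)) = g (xMon R (1, 0))) (h₂ : f (xMon R (0, 1)) = g (xMon R (0, 1))) :
    f = g := by
  have e₁ := laurent_algHom_ext
    (f := f.comp (AddMonoidAlgebra.mapDomainAlgHom R R (AddMonoidHom.inl ℤ ℤ)))
    (g := g.comp (AddMonoidAlgebra.mapDomainAlgHom R R (AddMonoidHom.inl ℤ ℤ)))
    (by simpa only [AlgHom.comp_apply, AddMonoidAlgebra.mapDomainAlgHom_apply, LaurentPolynomial.T,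
      AddMonoidAlgebra.mapDomain_single, AddMonoidHom.inl_apply] using h₁)
  have e₂ := laurent_algHom_ext
    (f := f.comp (AddMonoidAlgebra.mapDomainAlgHom R R (AddMonoidHom.inr ℤ ℤ)))
    (g := g.comp (AddMonoidAlgebra.mapDomainAlgHom R R (AddMonoidHom.inr ℤ ℤ)))
    (by simpa only [AlgHom.comp_apply, AddMonoidAlgebra.mapDomainAlgHom_apply, LaurentPolynomial.T,
      AddMonoidAlgebra.mapDomain_single, AddMonoidHom.inr_apply] using h₂)
  refine AddMonoidAlgebra.algHom_ext (fun v => ?_) (by ext)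
  have k₁ := DFunLike.congr_fun e₁ (LaurentPolynomial.T v.1)
  have k₂ := DFunLike.congr_fun e₂ (LaurentPolynomial.T v.2)
  simp only [AlgHom.comp_apply, AddMonoidAlgebra.mapDomainAlgHom_apply, LaurentPolynomial.T,
    AddMonoidAlgebra.mapDomain_single, AddMonoidHom.inl_apply, AddMonoidHom.inr_apply] at k₁ k₂
  have hv : AddMonoidAlgebra.single v (1 : R) =
      AddMonoidAlgebra.single (v.1, 0) 1 * AddMonoidAlgebra.single (0, v.2) 1 := by
    simp [AddMonoidAlgebra.single_mul_single]
  rw [hv, map_mul, map_mul, k₁, k₂]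

theorem sub_one_dvd_map_sub_one {S : Type*} [CommRing S] (f : Multiplicative ℤ →* S)
    (n : Multiplicative ℤ) : f (.ofAdd 1) - 1 ∣ f n - 1 := by
  let q := Ideal.Quotient.mk (Ideal.span {f (.ofAdd 1) - 1})
  have h : q.toMonoidHom.comp f = 1 := MonoidHom.ext_mint <|
    (Ideal.Quotient.eq.2 (Ideal.mem_span_singleton_self _)).trans q.map_one
  exact Ideal.mem_span_singleton.1 <|
    Ideal.Quotient.eq.1 ((DFunLike.congr_fun h n).trans q.map_one.symm)

/-- The candidate preimage `f₁(x₁) + f₂(x₂) - f₁(1)` of a pair `(f₁, f₂)`. -/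
noncomputable def gkmLift (R : Type*) [CommRing R] :
    (Fin 2 → LaurentPolynomial R) →ₗ[R] AddMonoidAlgebra R (ℤ × ℤ) :=
  (AddMonoidAlgebra.mapDomainAlgHom R R (AddMonoidHom.inl ℤ ℤ)).toLinearMap ∘ₗ LinearMap.proj 0 +
  (AddMonoidAlgebra.mapDomainAlgHom R R (AddMonoidHom.inr ℤ ℤ)).toLinearMap ∘ₗ LinearMap.proj 1 -
  (AddMonoidAlgebra.mapDomainAlgHom R R (0 : ℤ →+ ℤ × ℤ)).toLinearMap ∘ₗ LinearMap.proj 0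

/-- The localization map at the two fixed points, `x₁ ↦ (χ, 1)` and `x₂ ↦ (1, χ)`. -/
noncomputable def gkmHom (R : Type*) [CommRing R] :
    AddMonoidAlgebra R (ℤ × ℤ) →ₐ[R] (Fin 2 → LaurentPolynomial R) :=
  AlgHom.pi ![AddMonoidAlgebra.mapDomainAlgHom R R (AddMonoidHom.fst ℤ ℤ),
    AddMonoidAlgebra.mapDomainAlgHom R R (AddMonoidHom.snd ℤ ℤ)]

theorem gkmHom_single {R : Type*} [CommRing R] (v : ℤ × ℤ) (r : R) :
    gkmHom R (.single v r) = ![.single v.1 r, .single v.2 r] := by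
  ext i : 1
  fin_cases i <;> simp [gkmHom]

theorem sub_gkmLift_gkmHom_mem {R : Type*} [CommRing R] (F : AddMonoidAlgebra R (ℤ × ℤ)) :
    F - gkmLift R (gkmHom R F) ∈ Ideal.span {(xMon R (1, 0) - 1) * (xMon R (0, 1) - 1)} := by
  induction F using AddMonoidAlgebra.induction_linear with
  | zero => simp
  | add F G hF hG =>
    rw [map_add, map_add, add_sub_add_comm]
    exact add_mem hF hG
  | single v r =>
    have d₁ := sub_one_dvd_map_sub_one
      ((AddMonoidAlgebra.of R (ℤ × ℤ)).comp (AddMonoidHom.inl ℤ ℤ).toMultiplicative) (.ofAdd v.1)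
    have d₂ := sub_one_dvd_map_sub_one
      ((AddMonoidAlgebra.of R (ℤ × ℤ)).comp (AddMonoidHom.inr ℤ ℤ).toMultiplicative) (.ofAdd v.2)
    have key : AddMonoidAlgebra.single v r - gkmLift R (gkmHom R (.single v r)) =
        AddMonoidAlgebra.single 0 r * ((xMon R (v.1, 0) - 1) * (xMon R (0, v.2) - 1)) := by
      rw [gkmHom_single]
      simp [gkmLift, -LaurentPolynomial.single_eq_C_mul_T, mul_sub, sub_mul, AddMonoidAlgebra.single_mul_single,
        AddMonoidAlgebra.one_def]
      abel
    rw [key, Ideal.mem_span_singleton]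
    exact (mul_dvd_mul d₁ d₂).mul_left _

theorem gkmHom_apply_sub_mem {R : Type*} [CommRing R] (F : AddMonoidAlgebra R (ℤ × ℤ)) :
    gkmHom R F 0 - gkmHom R F 1 ∈ Ideal.span {1 - LaurentPolynomial.T (R := R) 1} := by
  let q := Ideal.Quotient.mkₐ R (Ideal.span {1 - LaurentPolynomial.T (R := R) 1})
  have hq : q 1 = q (LaurentPolynomial.T 1) :=
    Ideal.Quotient.eq.2 (Ideal.mem_span_singleton_self _)
  have h : q.comp ((Pi.evalAlgHom R _ 0).comp (gkmHom R)) =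
      q.comp ((Pi.evalAlgHom R _ 1).comp (gkmHom R)) := by
    apply laurent₂_algHom_ext
    · simpa [gkmHom_single] using hq.symm
    · simpa [gkmHom_single] using hq
  exact Ideal.Quotient.eq.1 (DFunLike.congr_fun h F)

theorem gkmHom_gkmLift {R : Type*} [CommRing R] {f : Fin 2 → LaurentPolynomial R}
    (hf : f 0 - f 1 ∈ Ideal.span {1 - LaurentPolynomial.T (R := R) 1}) :
    gkmHom R (gkmLift R f) = f := by
  let e := AddMonoidAlgebra.mapDomainAlgHom R R (0 : ℤ →+ ℤ)
  have he : e (f 0) = e (f 1) := by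
    obtain ⟨c, hc⟩ := Ideal.mem_span_singleton.1 hf
    have h1 : e (1 - LaurentPolynomial.T 1) = 0 := by
      rw [map_sub, map_one]
      simp [e, LaurentPolynomial.T, -LaurentPolynomial.single_eq_C_mul_T,
        AddMonoidAlgebra.one_def]
    rw [← sub_eq_zero, ← map_sub, hc, map_mul, h1, zero_mul]
  have hcomp {M N O : Type} [AddMonoid M] [AddMonoid N] [AddMonoid O] (g : N →+ O) (h : M →+ N)
      (F : AddMonoidAlgebra R M) : AddMonoidAlgebra.mapDomainAlgHom R R g
        (AddMonoidAlgebra.mapDomainAlgHom R R h F) =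
        AddMonoidAlgebra.mapDomainAlgHom R R (g.comp h) F := by
    rw [AddMonoidAlgebra.mapDomainAlgHom_comp]; rfl
  have hid (F : LaurentPolynomial R) :
      AddMonoidAlgebra.mapDomainAlgHom R R (AddMonoidHom.id ℤ) F = F := by
    rw [AddMonoidAlgebra.mapDomainAlgHom_id]; rfl
  have h0 : gkmHom R (gkmLift R f) 0 = f 0 + e (f 1) - e (f 0) := by
    conv_rhs => rw [← hid (f 0)]
    simp only [gkmHom, gkmLift, e, AlgHom.pi_apply, Matrix.cons_val_zero, LinearMap.sub_apply,
      LinearMap.add_apply, LinearMap.comp_apply, LinearMap.proj_apply, AlgHom.toLinearMap_apply,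
      map_add, map_sub, hcomp]
    rfl
  have h1 : gkmHom R (gkmLift R f) 1 = e (f 0) + f 1 - e (f 0) := by
    conv_rhs => rw [← hid (f 1)]
    simp only [gkmHom, gkmLift, e, AlgHom.pi_apply, Matrix.cons_val_one, Matrix.cons_val_zero, LinearMap.sub_apply,
      LinearMap.add_apply, LinearMap.comp_apply, LinearMap.proj_apply, AlgHom.toLinearMap_apply,
      map_add, map_sub, hcomp]
    rfl
  ext i : 1
  fin_cases i
  · simpa [he] using h0
  · simpa using h1

theorem stmt_0 (R : Type*) [CommRing R]
    -- φ is the R-algebra homomorphism determined by x₁ ↦ (χ, 1), x₂ ↦ (1, χ)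
    (φ : AddMonoidAlgebra R (ℤ × ℤ) →ₐ[R] (Fin 2 → LaurentPolynomial R))
    (hx1 : φ (xMon R (1, 0)) = ![LaurentPolynomial.T 1, 1])
    (hx2 : φ (xMon R (0, 1)) = ![1, LaurentPolynomial.T 1])
    -- T' is the subring {(f₁, f₂) ∈ A × A : f₁ − f₂ ∈ (1 − χ)A}
    (T' : Subalgebra R (Fin 2 → LaurentPolynomial R))
    (hT' : (T' : Set (Fin 2 → LaurentPolynomial R)) =
      {f | f 0 - f 1 ∈ Ideal.span {1 - LaurentPolynomial.T 1}}) :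
    -- the kernel of φ is the principal ideal generated by (x₁ − 1)(x₂ − 1)
    RingHom.ker φ = Ideal.span {(xMon R (1, 0) - 1) * (xMon R (0, 1) - 1)} ∧
    -- the image of φ equals the subring T'
    (φ.range : Set (Fin 2 → LaurentPolynomial R)) = (T' : Set (Fin 2 → LaurentPolynomial R)) ∧
    -- consequently R[x₁^{±1}, x₂^{±1}]/((x₁ − 1)(x₂ − 1)) ≅ T' as R-algebras
    Nonempty ((AddMonoidAlgebra R (ℤ × ℤ) ⧸
      Ideal.span {(xMon R (1, 0) - 1) * (xMon R (0, 1) - 1)}) ≃ₐ[R] T') := by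
  obtain rfl : φ = gkmHom R := laurent₂_algHom_ext
    (by rw [hx1, gkmHom_single]; rfl) (by rw [hx2, gkmHom_single]; rfl)
  have hker : RingHom.ker (gkmHom R) =
      Ideal.span {(xMon R (1, 0) - 1) * (xMon R (0, 1) - 1)} := by
    refine le_antisymm (fun F hF => ?_) ?_
    · simpa [(RingHom.mem_ker).1 hF] using sub_gkmLift_gkmHom_mem F
    · rw [Ideal.span_singleton_le_iff_mem, RingHom.mem_ker, map_mul, map_sub, map_sub, hx1, hx2,
        map_one]
      ext i : 1
      fin_cases i
      · exact mul_eq_zero_of_right _ (sub_self 1)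
      · exact mul_eq_zero_of_left (sub_self 1) _
  have hrange : ((gkmHom R).range : Set (Fin 2 → LaurentPolynomial R)) = T' := by
    rw [hT']
    refine Set.Subset.antisymm ?_ fun f hf => ⟨gkmLift R f, gkmHom_gkmLift hf⟩
    rintro _ ⟨F, rfl⟩
    exact gkmHom_apply_sub_mem F
  refine ⟨hker, hrange, ⟨?_⟩⟩
  exact ((Ideal.quotientEquivAlgOfEq R hker.symm).trans
    (Ideal.quotientKerEquivRange (gkmHom R))).trans
    (Subalgebra.equivOfEq _ _ (SetLike.coe_injective hrange))
end

section
/- Let R be a commutative ring and B = R[χ^{±1}]. Let ι: B → B be the ring involution determined by ι(χ) = χ^{−1}. Consider the subring S = {(f₁, f₂) ∈ B × B : f₁ − f₂ ∈ (1 − χ)B} and the ring involution σ on S given by σ(f₁, f₂) = (ι(f₂), ι(f₁)). Then the fixed subring S^σ is mapped isomorphically onto B by the projection (f₁, f₂) ↦ f₁; in particular the fixed subring of the GKM ring of ℙ¹ under the Weyl group action is isomorphic to R[χ^{±1}]. -/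
/-!
STATEMENT 10: The SL₂-equivariant K-theory of ℙ¹ as Weyl invariants of the GKM ring.

`B = R[χ^{±1}]` is `LaurentPolynomial R` with `χ = LaurentPolynomial.T 1`, and the
product `B × B` is realized as `Fin 2 → B`.  `ι` is the ring involution of `B`
determined by `ι(χ) = χ⁻¹`, and `σ` is the ring homomorphism of `B × B` given by
`σ(f₁, f₂) = (ι(f₂), ι(f₁))` (the Weyl group action).  The conclusion: the fixed
subring `Sᵠ` of `S = {(f₁,f₂) : f₁ − f₂ ∈ (1 − χ)B}` under `σ` is mapped
isomorphically onto `B` by the projection `(f₁, f₂) ↦ f₁`.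
-/

open LaurentPolynomial in
/-- The substitution `T ↦ T⁻¹` is trivial modulo `1 - T`. -/
theorem LaurentPolynomial.sub_map_mem_span_one_sub_T {R : Type*} [CommRing R]
    (ι : LaurentPolynomial R →ₐ[R] LaurentPolynomial R) (hι : ι (T 1) = T (-1))
    (f : LaurentPolynomial R) : f - ι f ∈ Ideal.span {1 - T 1} := by
  set I : Ideal (LaurentPolynomial R) := Ideal.span {1 - T 1}
  have hT : Ideal.Quotient.mk I (T 1) = 1 :=
    (Ideal.Quotient.eq.mpr (Ideal.mem_span_singleton_self _)).symm
  have hT' : Ideal.Quotient.mk I (T (-1)) = 1 := by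
    rw [← one_mul (Ideal.Quotient.mk I (T (-1))), ← hT, ← map_mul, ← T_add]
    simp [hT]
  have h : Ideal.Quotient.mkₐ R I = (Ideal.Quotient.mkₐ R I).comp ι := by
    refine AddMonoidAlgebra.algHom_ext' ?_ (Subsingleton.elim _ _)
    apply MonoidHom.ext_mint
    change Ideal.Quotient.mk I (T 1) = Ideal.Quotient.mk I (ι (T 1))
    rw [hι, hT, hT']
  exact Ideal.Quotient.eq.mp (DFunLike.congr_fun h f)

theorem stmt_10 (R : Type*) [CommRing R]
    (ι : LaurentPolynomial R →ₐ[R] LaurentPolynomial R)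
    (hι : ι (LaurentPolynomial.T 1) = LaurentPolynomial.T (-1))
    (hinv : ∀ f, ι (ι f) = f)
    (σ : (Fin 2 → LaurentPolynomial R) →+* (Fin 2 → LaurentPolynomial R))
    (hσ : ∀ f, σ f = ![ι (f 1), ι (f 0)]) :
    -- the fixed points of σ inside S form a subring F, and the projection
    -- (f₁, f₂) ↦ f₁ maps F isomorphically onto B
    ∃ F : Subring (Fin 2 → LaurentPolynomial R),
      (F : Set (Fin 2 → LaurentPolynomial R)) =
        {f | f 0 - f 1 ∈ Ideal.span {1 - LaurentPolynomial.T 1} ∧ σ f = f} ∧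
      Function.Bijective
        ((Pi.evalRingHom (fun _ : Fin 2 => LaurentPolynomial R) 0).comp F.subtype) := by
  let B := LaurentPolynomial R
  let I : Ideal B := Ideal.span {1 - LaurentPolynomial.T 1}
  let p (i : Fin 2) : (Fin 2 → B) →+* B ⧸ I :=
    (Ideal.Quotient.mk I).comp (Pi.evalRingHom (fun _ : Fin 2 => B) i)
  have hF : (((p 0).eqLocus (p 1) ⊓ σ.eqLocus (RingHom.id _) : Subring (Fin 2 → B)) :
      Set (Fin 2 → B)) = {f | f 0 - f 1 ∈ I ∧ σ f = f} := by
    ext f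
    exact and_congr_left fun _ => Ideal.Quotient.eq
  refine ⟨_, hF, ?_, ?_⟩
  · rintro ⟨f, hf⟩ ⟨g, hg⟩ (hfg : f 0 = g 0)
    have snd_eq {f : Fin 2 → B} (h : σ f = f) : f 1 = ι (f 0) := by
      simpa [hσ] using (congrFun h 1).symm
    refine Subtype.ext (funext (Fin.forall_fin_two.mpr ⟨hfg, ?_⟩))
    change f 1 = g 1
    rw [snd_eq hf.2, snd_eq hg.2, hfg]
  · intro b
    refine ⟨⟨![b, ι b], ?_⟩, rfl⟩
    rw [← SetLike.mem_coe, hF]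
    exact ⟨LaurentPolynomial.sub_map_mem_span_one_sub_T ι hι b, by simp [hσ, hinv]⟩
end

section
/- Let R be a commutative ring, let n ≥ 1 be an integer, and B = R[χ^{±1}]. Let T = {(f₁, f₂, f₃, f₄) ∈ B⁴ : f₁ − f₂ ∈ (1 − χ)B, f₂ − f₃ ∈ (1 − χ^{2n})B, f₃ − f₄ ∈ (1 − χ)B, f₄ − f₁ ∈ (1 − χⁿ)B}. Then the set {(f₁, f₂, f₃, f₄) ∈ T : f₁ = f₃} is a subring of T, and the map (f₁, f₂, f₃, f₄) ↦ (f₁, f₂, f₄) is a ring isomorphism from it onto the subring {(g₁, g₂, g₃) ∈ B³ : g₁ − g₂ ∈ (1 − χ^{2n})B and g₁ − g₃ ∈ (1 − χⁿ)B}. -/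
/-!
STATEMENT 13: The SL₂-equivariant K-theory of the Hirzebruch surface 𝔽ₙ as Weyl
invariants of the GKM ring T.

`B = R[χ^{±1}]` is `LaurentPolynomial R` with `χ = LaurentPolynomial.T 1`; products
`B⁴`, `B³` are realized as `Fin 4 → B`, `Fin 3 → B`.  `P` is the ring homomorphism
`(f₁,f₂,f₃,f₄) ↦ (f₁,f₂,f₄)`.  The conclusion: the subset of
`T = {(f₁,f₂,f₃,f₄) : f₁−f₂ ∈ (1−χ)B, f₂−f₃ ∈ (1−χ^{2n})B, f₃−f₄ ∈ (1−χ)B,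
f₄−f₁ ∈ (1−χⁿ)B}` cut out by `f₁ = f₃` is a subring, and `P` restricts to a ring
isomorphism from it onto
`{(g₁,g₂,g₃) ∈ B³ : g₁ − g₂ ∈ (1−χ^{2n})B and g₁ − g₃ ∈ (1−χⁿ)B}`.
-/

/-- The subring of tuples whose `i`-th and `j`-th entries agree modulo the ideal `I`. -/
def congruenceSubring {ι A : Type*} [CommRing A] (i j : ι) (I : Ideal A) : Subring (ι → A) :=
  RingHom.eqLocus ((Ideal.Quotient.mk I).comp (Pi.evalRingHom (fun _ => A) i))
    ((Ideal.Quotient.mk I).comp (Pi.evalRingHom (fun _ => A) j))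

theorem mem_congruenceSubring {ι A : Type*} [CommRing A] {i j : ι} {I : Ideal A} {f : ι → A} :
    f ∈ congruenceSubring i j I ↔ f i - f j ∈ I :=
  Ideal.Quotient.eq

theorem stmt_13 (R : Type*) [CommRing R] (n : ℕ) (hn : 1 ≤ n)
    (P : (Fin 4 → LaurentPolynomial R) →+* (Fin 3 → LaurentPolynomial R))
    (hP : ∀ f, P f = ![f 0, f 1, f 3]) :
    ∃ F : Subring (Fin 4 → LaurentPolynomial R),
      -- F is the subset {(f₁,f₂,f₃,f₄) ∈ T : f₁ = f₃} (in particular it is a subring)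
      (F : Set (Fin 4 → LaurentPolynomial R)) =
        {f | (f 0 - f 1 ∈ Ideal.span {1 - LaurentPolynomial.T 1} ∧
              f 1 - f 2 ∈ Ideal.span {1 - LaurentPolynomial.T 1 ^ (2 * n)} ∧
              f 2 - f 3 ∈ Ideal.span {1 - LaurentPolynomial.T 1} ∧
              f 3 - f 0 ∈ Ideal.span {1 - LaurentPolynomial.T 1 ^ n}) ∧
             f 0 = f 2} ∧
      -- P restricted to F is injective ...
      Function.Injective (P.comp F.subtype) ∧
      -- ... with image {(g₁,g₂,g₃) ∈ B³ : g₁−g₂ ∈ (1−χ^{2n})B, g₁−g₃ ∈ (1−χⁿ)B},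
      -- i.e. P restricts to a ring isomorphism from F onto that subring
      Set.range ⇑(P.comp F.subtype) =
        {g : Fin 3 → LaurentPolynomial R |
          g 0 - g 1 ∈ Ideal.span {1 - LaurentPolynomial.T 1 ^ (2 * n)} ∧
          g 0 - g 2 ∈ Ideal.span {1 - LaurentPolynomial.T 1 ^ n}} := by
  have span_le (m : ℕ) : Ideal.span {1 - LaurentPolynomial.T 1 ^ m} ≤
      Ideal.span {1 - (LaurentPolynomial.T 1 : LaurentPolynomial R)} :=
    Ideal.span_singleton_le_span_singleton.2 (one_sub_dvd_one_sub_pow _ m)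
  refine ⟨congruenceSubring 0 1 (Ideal.span {1 - LaurentPolynomial.T 1}) ⊓
      congruenceSubring 1 2 (Ideal.span {1 - LaurentPolynomial.T 1 ^ (2 * n)}) ⊓
      congruenceSubring 2 3 (Ideal.span {1 - LaurentPolynomial.T 1}) ⊓
      congruenceSubring 3 0 (Ideal.span {1 - LaurentPolynomial.T 1 ^ n}) ⊓
      congruenceSubring 0 2 ⊥, ?_, ?_, ?_⟩
  · ext f
    simp [mem_congruenceSubring, sub_eq_zero, and_assoc]
  · rintro ⟨f, hf⟩ ⟨g, hg⟩ h
    simp only [Subring.mem_inf, mem_congruenceSubring, Ideal.mem_bot, sub_eq_zero] at hf hg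
    simp only [RingHom.comp_apply, Subring.subtype_apply, hP] at h
    have h0 : f 0 = g 0 := congrFun h 0
    have h1 : f 1 = g 1 := congrFun h 1
    have h3 : f 3 = g 3 := congrFun h 2
    have h2 : f 2 = g 2 := by rw [← hf.2, ← hg.2, h0]
    ext i : 2
    fin_cases i <;> assumption
  · ext g
    simp only [Set.mem_range, Set.mem_ofPred_eq, RingHom.comp_apply, Subring.subtype_apply, hP]
    constructor
    · rintro ⟨⟨f, hf⟩, rfl⟩
      simp only [Subring.mem_inf, mem_congruenceSubring, Ideal.mem_bot, sub_eq_zero] at hf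
      obtain ⟨⟨⟨⟨-, h12⟩, -⟩, h30⟩, h02⟩ := hf
      rw [← h02] at h12
      exact ⟨sub_mem_comm_iff.1 h12, sub_mem_comm_iff.1 h30⟩
    · rintro ⟨h01, h02⟩
      refine ⟨⟨![g 0, g 1, g 0, g 2], ?_⟩, ?_⟩
      · simp only [Subring.mem_inf, mem_congruenceSubring, Ideal.mem_bot, sub_eq_zero]
        exact ⟨⟨⟨⟨span_le _ h01, sub_mem_comm_iff.1 h01⟩, span_le _ h02⟩,
          sub_mem_comm_iff.1 h02⟩, rfl⟩
      · ext i : 1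
        fin_cases i <;> rfl
end
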